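/- Let K be a field of prime characteristic p and C a cyclic group of order q = p^k (k ≥ 1) with generator g. For 1 ≤ s ≤ q let V_s = K[C]/((g−1)^s). Then for every n ≥ 1 there is an isomorphism of K[C]-modules (S^n(K[C]))^{⊕n} ≅ ⊕_{j=1}^{n} ( V_{q/gcd(j,q)} )^{⊕ gcd(j,q)} ⊗_K S^{n−j}(K[C]), where S^0(K[C]) denotes the trivial one-dimensional module. -/

import Mathlib

noncomputable section

variable (K : Type) [Field K] (C : Type) [CommGroup C]

/-- The indecomposable `K[C]`-module `V_s = K[C]/((g−1)^s)` for a cyclic group `C` with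
generator `g`. -/
abbrev Vmod (g : C) (s : ℕ) : Type :=
  MonoidAlgebra K C ⧸ Ideal.span {((MonoidAlgebra.of K C g : MonoidAlgebra K C) - 1) ^ s}

/-- The action of the generator `g` on `V_s`, by multiplication. -/
def VmodAct (g : C) (s : ℕ) : Vmod K C g s →ₗ[K] Vmod K C g s :=
  LinearMap.mulLeft K (Ideal.Quotient.mk _ (MonoidAlgebra.of K C g))

/-- The `m`-th symmetric power `S^m K[C]` of the regular module, realised as the space
of homogeneous polynomials of degree `m` in variables indexed by the elements of `C`.
(For `m = 0` this is the trivial one-dimensional module.) -/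
abbrev SymPow (m : ℕ) : Type := MvPolynomial.homogeneousSubmodule C K m

/-- The action of `g ∈ C` on `S^m K[C]`, translating the variables. -/
def SymAct (g : C) (m : ℕ) : SymPow K C m →ₗ[K] SymPow K C m :=
  (MvPolynomial.rename (fun x : C => g * x)).toLinearMap.restrict
    (fun _ hx => by
      rw [MvPolynomial.mem_homogeneousSubmodule] at hx ⊢
      exact hx.rename_isHomogeneous)

/-- The `j`-th term `(V_{q/gcd(j,q)})^{⊕ gcd(j,q)} ⊗ S^{n−j}(K[C])` of Newton's formula
for the regular module. -/
abbrev SymTerm (g : C) (q n j : ℕ) : Type :=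
  TensorProduct K (Fin (Nat.gcd j q) → Vmod K C g (q / Nat.gcd j q)) (SymPow K C (n - j))

/-- The action of the generator `g` on the `j`-th term (componentwise on the copies,
diagonal on the tensor product). -/
def SymTermAct (g : C) (q n j : ℕ) : SymTerm K C g q n j →ₗ[K] SymTerm K C g q n j :=
  TensorProduct.map
    (LinearMap.compLeft (VmodAct K C g (q / Nat.gcd j q)) (Fin (Nat.gcd j q)))
    (SymAct K C g (n - j))


open Function in
theorem card_iterate_eq_self_eq_sum_card_minimalPeriod {X : Type*} [Finite X] (f : X → X) {d : ℕ}
    (hd : 0 < d) :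
    Nat.card {x // f^[d] x = x} = ∑ e ∈ d.divisors, Nat.card {x // minimalPeriod f x = e} := by
  classical
  have := Fintype.ofFinite X
  simp only [Nat.card_eq_fintype_card, Fintype.card_subtype]
  rw [Finset.card_eq_sum_card_fiberwise (f := minimalPeriod f) (t := d.divisors)]
  · refine Finset.sum_congr rfl fun e he => ?_
    rw [Finset.filter_filter]
    congr 1
    ext z
    simp only [Finset.mem_filter, Finset.mem_univ, true_and, and_iff_right_iff_imp]
    rintro rfl
    exact (isPeriodicPt_iff_minimalPeriod_dvd (f := f)).2 (Nat.dvd_of_mem_divisors he)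
  · intro z hz
    have hz' : IsPeriodicPt f d z := (Finset.mem_filter.1 (Finset.mem_coe.1 hz)).2
    simpa [hd.ne'] using hz'.minimalPeriod_dvd

open Function in
/-- The number of fixed points of the iterates determines the number of points of each
minimal period. -/
theorem card_minimalPeriod_eq_of_card_iterate_eq_self {X Y : Type*} [Finite X] [Finite Y]
    (σ : X → X) (τ : Y → Y)
    (h : ∀ r : ℕ, Nat.card {x // σ^[r] x = x} = Nat.card {y // τ^[r] y = y}) :
    ∀ d : ℕ, 0 < d →
      Nat.card {x // minimalPeriod σ x = d} = Nat.card {y // minimalPeriod τ y = d} := by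
  intro d
  induction d using Nat.strong_induction_on with
  | _ d ih =>
    intro hd
    have h1 := h d
    rw [card_iterate_eq_self_eq_sum_card_minimalPeriod σ hd,
      card_iterate_eq_self_eq_sum_card_minimalPeriod τ hd,
      ← Nat.insert_self_properDivisors hd.ne',
      Finset.sum_insert Nat.self_notMem_properDivisors,
      Finset.sum_insert Nat.self_notMem_properDivisors,
      Finset.sum_congr rfl fun e he => ih e (Nat.mem_properDivisors.1 he).2
        (Nat.pos_of_mem_properDivisors he)] at h1
    exact Nat.add_right_cancel h1

open Function in
theorem Equiv.Perm.minimalPeriod_eq_card_support_cycleOf {X : Type*} [Fintype X] [DecidableEq X]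
    (σ : Equiv.Perm X) {x : X} (hx : σ x ≠ x) :
    minimalPeriod σ x = (σ.cycleOf x).support.card := by
  have hc := σ.isCycle_cycleOf hx
  have h : ∀ k, minimalPeriod σ x ∣ k ↔ (σ.cycleOf x).support.card ∣ k := by
    intro k
    rw [← isPeriodicPt_iff_minimalPeriod_dvd, ← hc.orderOf, orderOf_dvd_iff_pow_eq_one,
      hc.pow_eq_one_iff' (x := x) (by simpa using hx), cycleOf_pow_apply_self, IsPeriodicPt,
      IsFixedPt, iterate_eq_pow]
  exact Nat.dvd_antisymm ((h _).2 dvd_rfl) ((h _).1 dvd_rfl)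

open Function in
theorem Equiv.Perm.count_cycleType_mul {X : Type*} [Fintype X] [DecidableEq X]
    (σ : Equiv.Perm X) {d : ℕ} (hd : 2 ≤ d) :
    σ.cycleType.count d * d = Nat.card {x // minimalPeriod σ x = d} := by
  rw [cycleType_def, Multiset.count_map, Nat.card_eq_fintype_card, Fintype.card_subtype]
  change (σ.cycleFactorsFinset.filter fun c => d = (Finset.card ∘ support) c).card * d = _
  have hmoved : ∀ x, minimalPeriod σ x = d → σ x ≠ x := by
    intro x hx h
    have := minimalPeriod_eq_one_iff_isFixedPt.2 (show IsFixedPt σ x from h)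
    omega
  rw [Finset.card_eq_sum_card_fiberwise (f := σ.cycleOf)
    (t := σ.cycleFactorsFinset.filter fun c => d = (Finset.card ∘ support) c),
    Finset.sum_const_nat (m := d)]
  · intro c hc
    obtain ⟨hc, hcd⟩ := Finset.mem_filter.1 hc
    rw [hcd]
    simp only [comp_apply]
    congr 1
    ext x
    simp only [Finset.mem_filter, Finset.mem_univ, true_and]
    constructor
    · rintro ⟨h, rfl⟩
      simpa using hmoved x (h.trans hcd.symm)
    · intro hx
      have hcx := (eq_cycleOf_of_mem_cycleFactorsFinset_iff σ c hc x).2 hx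
      have hx' : σ x ≠ x := mem_support.1 (mem_cycleFactorsFinset_support_le hc hx)
      exact ⟨by rw [minimalPeriod_eq_card_support_cycleOf σ hx', hcx], hcx.symm⟩
  · intro x hx
    have hx : minimalPeriod σ x = d := by simpa using hx
    have hx' := hmoved x hx
    simp only [Finset.coe_filter, comp_apply]
    exact ⟨cycleOf_mem_cycleFactorsFinset_iff.2 (mem_support.2 hx'),
      by rw [← hx, minimalPeriod_eq_card_support_cycleOf σ hx']⟩

theorem Equiv.Perm.isConj_of_card_pow_apply_eq_self {X : Type*} [Finite X] (σ τ : Equiv.Perm X)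
    (h : ∀ r : ℕ, Nat.card {x // (σ ^ r) x = x} = Nat.card {x // (τ ^ r) x = x}) :
    IsConj σ τ := by
  classical
  have := Fintype.ofFinite X
  rw [isConj_iff_cycleType_eq]
  ext d
  by_cases hd : 2 ≤ d
  · refine Nat.eq_of_mul_eq_mul_right (by omega : 0 < d) ?_
    rw [count_cycleType_mul σ hd, count_cycleType_mul τ hd]
    exact card_minimalPeriod_eq_of_card_iterate_eq_self σ τ
      (by simpa only [iterate_eq_pow] using h) d (by omega)
  · rw [Multiset.count_eq_zero_of_notMem fun hm => hd (two_le_of_mem_cycleType hm),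
      Multiset.count_eq_zero_of_notMem fun hm => hd (two_le_of_mem_cycleType hm)]

/-- Two finite sets with an action of a cyclic group are isomorphic as soon as each element of the
group has equally many fixed points on them. -/
theorem MulAction.exists_equiv_of_card_fixedBy {G X Y : Type*} [Group G] [MulAction G X]
    [MulAction G Y] [Finite X] [Finite Y] (g : G)
    (h : ∀ c : G, Nat.card (fixedBy X c) = Nat.card (fixedBy Y c)) :
    ∃ φ : X ≃ Y, ∀ x, φ (g • x) = g • φ x := by
  have hXY : Nat.card X = Nat.card Y := by
    have h1 := h 1
    rwa [fixedBy_one_eq_univ, fixedBy_one_eq_univ, Nat.card_univ, Nat.card_univ] at h1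
  obtain ⟨ψ⟩ := (Finite.card_eq).1 hXY
  have hpow : ∀ r : ℕ, (ψ.symm.permCongr (toPerm g)) ^ r = ψ.symm.permCongr (toPerm (g ^ r)) := by
    intro r
    have := (map_pow (ψ.symm.permCongrHom.toMonoidHom.comp (toPermHom G Y)) g r).symm
    exact this
  have hconj : IsConj (toPerm g : Equiv.Perm X) (ψ.symm.permCongr (toPerm g)) := by
    refine Equiv.Perm.isConj_of_card_pow_apply_eq_self _ _ fun r => ?_
    rw [hpow, show (toPerm g : Equiv.Perm X) ^ r = toPerm (g ^ r) from
      (map_pow (toPermHom G X) g r).symm]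
    refine (h (g ^ r)).trans (Nat.card_congr (ψ.symm.subtypeEquiv fun y => ?_))
    simp [mem_fixedBy]
  obtain ⟨κ, hκ⟩ := isConj_iff.1 hconj
  refine ⟨κ.trans ψ, fun x => ?_⟩
  have := congrArg ψ (congrArg (fun π : Equiv.Perm X => π (κ x)) hκ)
  simpa using this

/-- The functions `G → ℕ` with sum `n` which are invariant under translation by `c`. -/
def invariantPiAntidiag {G : Type*} [Group G] [Fintype G] [DecidableEq G] (c : G) (n : ℕ) :
    Finset (G → ℕ) :=
  (Finset.univ.piAntidiag n).filter fun f => ∀ y, f (c * y) = f y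

theorem mem_invariantPiAntidiag {G : Type*} [Group G] [Fintype G] [DecidableEq G] {c : G} {n : ℕ}
    {f : G → ℕ} :
    f ∈ invariantPiAntidiag c n ↔ ∑ y, f y = n ∧ ∀ y, f (c * y) = f y := by
  simp [invariantPiAntidiag]

theorem apply_eq_of_mul_inv_mem_zpowers {G : Type*} [Group G] [Finite G] {α : Type*} {c : G}
    {f : G → α} (hf : ∀ y, f (c * y) = f y) {x y : G} (h : y * x⁻¹ ∈ Subgroup.zpowers c) :
    f y = f x := by
  obtain ⟨k, hk⟩ := (mem_powers_iff_mem_zpowers.2 h)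
  have : ∀ k : ℕ, f (c ^ k * x) = f x := by
    intro k
    induction k with
    | zero => simp
    | succ k ih => rw [pow_succ', mul_assoc, hf, ih]
  rw [← this k, show c ^ k = y * x⁻¹ from hk, inv_mul_cancel_right]

theorem card_filter_le_apply_invariantPiAntidiag {G : Type*} [Group G] [Fintype G] [DecidableEq G]
    (c : G) (n i : ℕ) (x : G) :
    ((invariantPiAntidiag c n).filter fun f => i ≤ f x).card =
      if orderOf c * i ≤ n then (invariantPiAntidiag c (n - orderOf c * i)).card else 0 := by
  classical
  let u : G → ℕ := fun y => if y * x⁻¹ ∈ Subgroup.zpowers c then i else 0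
  have hu : ∑ y, u y = orderOf c * i := by
    rw [← Equiv.sum_comp (Equiv.mulRight x)]
    simp only [u, Equiv.coe_mulRight, mul_inv_cancel_right]
    rw [← Finset.sum_filter, Finset.sum_const, smul_eq_mul, ← Nat.card_zpowers,
      Nat.card_eq_fintype_card, Fintype.card_subtype]
  have hu' : ∀ y, u (c * y) = u y := by
    intro y
    simp only [u, mul_assoc]
    simp only [Subgroup.mul_mem_cancel_left _ (Subgroup.mem_zpowers c)]
  have hux : u x = i := by simp [u]
  have hle : ∀ f : G → ℕ, (∀ y, f (c * y) = f y) → i ≤ f x → ∀ y, u y ≤ f y := by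
    intro f hf hi y
    by_cases hy : y * x⁻¹ ∈ Subgroup.zpowers c
    · simpa [u, hy, apply_eq_of_mul_inv_mem_zpowers hf hy] using hi
    · simp [u, hy]
  split_ifs with hn
  · refine Finset.card_nbij' (fun f => f - u) (fun f => f + u) ?_ ?_ ?_ ?_
    · intro f hf
      simp only [Finset.coe_filter, mem_invariantPiAntidiag, Set.mem_ofPred_eq] at hf
      obtain ⟨⟨hf, hfc⟩, hi⟩ := hf
      rw [Finset.mem_coe, mem_invariantPiAntidiag]
      refine ⟨?_, fun y => by simp [hfc, hu']⟩
      simp only [Pi.sub_apply]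
      rw [Finset.sum_tsub_distrib _ fun y _ => hle f hfc hi y, hf, hu]
    · intro f hf
      rw [Finset.mem_coe, mem_invariantPiAntidiag] at hf
      simp only [Finset.coe_filter, mem_invariantPiAntidiag, Set.mem_ofPred_eq]
      refine ⟨⟨?_, fun y => by simp [hf.2, hu']⟩, by simp [hux]⟩
      simp only [Pi.add_apply]
      rw [Finset.sum_add_distrib, hf.1, hu, Nat.sub_add_cancel hn]
    · intro f hf
      simp only [Finset.coe_filter, mem_invariantPiAntidiag, Set.mem_ofPred_eq] at hf
      ext y
      simpa using Nat.sub_add_cancel (hle f hf.1.2 hf.2 y)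
    · intro f hf
      ext y
      simp
  · rw [Finset.card_eq_zero, Finset.filter_eq_empty_iff]
    intro f hf hi
    rw [mem_invariantPiAntidiag] at hf
    apply hn
    rw [← hu, ← hf.1]
    exact Finset.sum_le_sum fun y _ => hle f hf.2 hi y

/-- Newton's formula for the numbers of invariant functions with a given sum. -/
theorem mul_card_invariantPiAntidiag {G : Type*} [Group G] [Fintype G] [DecidableEq G]
    (c : G) (n : ℕ) :
    n * (invariantPiAntidiag c n).card =
      ∑ j : Fin n, (if orderOf c ∣ (j : ℕ) + 1 then Fintype.card G else 0) *
        (invariantPiAntidiag c (n - (j + 1))).card := by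
  have hc : 0 < orderOf c := orderOf_pos c
  have h1 : ∀ x : G, ∑ f ∈ invariantPiAntidiag c n, f x =
      ∑ j ∈ Finset.Icc 1 n, if orderOf c ∣ j then (invariantPiAntidiag c (n - j)).card else 0 := by
    intro x
    calc ∑ f ∈ invariantPiAntidiag c n, f x
        = ∑ f ∈ invariantPiAntidiag c n, ∑ i ∈ Finset.Icc 1 n, if i ≤ f x then 1 else 0 := by
          refine Finset.sum_congr rfl fun f hf => ?_
          have hfx : f x ≤ n := by
            rw [← (mem_invariantPiAntidiag.1 hf).1]
            exact Finset.single_le_sum (fun _ _ => Nat.zero_le _) (Finset.mem_univ x)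
          rw [← Finset.card_filter]
          have : (Finset.Icc 1 n).filter (fun i => i ≤ f x) = Finset.Icc 1 (f x) := by
            ext i
            simp only [Finset.mem_filter, Finset.mem_Icc]
            omega
          simp [this]
      _ = ∑ i ∈ Finset.Icc 1 n, if orderOf c * i ≤ n then
            (invariantPiAntidiag c (n - orderOf c * i)).card else 0 := by
          rw [Finset.sum_comm]
          refine Finset.sum_congr rfl fun i _ => ?_
          rw [← Finset.card_filter, card_filter_le_apply_invariantPiAntidiag]
      _ = _ := by
          rw [← Finset.sum_filter, ← Finset.sum_filter]
          refine Finset.sum_bij (fun i _ => orderOf c * i) ?_ ?_ ?_ fun _ _ => rfl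
          · intro i hi
            simp only [Finset.mem_filter, Finset.mem_Icc] at hi ⊢
            exact ⟨⟨Nat.mul_pos hc hi.1.1, hi.2⟩, dvd_mul_right _ _⟩
          · intro i _ i' _ h
            exact Nat.eq_of_mul_eq_mul_left hc h
          · rintro j hj
            simp only [Finset.mem_filter, Finset.mem_Icc] at hj
            obtain ⟨⟨hj1, hjn⟩, i, rfl⟩ := hj
            refine ⟨i, ?_, rfl⟩
            simp only [Finset.mem_filter, Finset.mem_Icc]
            exact ⟨⟨Nat.pos_of_mul_pos_left hj1, (Nat.le_mul_of_pos_left i hc).trans hjn⟩, hjn⟩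
  calc n * (invariantPiAntidiag c n).card
      = ∑ f ∈ invariantPiAntidiag c n, ∑ x, f x := by
        rw [Finset.sum_congr rfl fun f hf => (mem_invariantPiAntidiag.1 hf).1, Finset.sum_const,
          smul_eq_mul, mul_comm]
    _ = _ := by
        rw [Finset.sum_comm, Finset.sum_congr rfl fun x _ => h1 x, Finset.sum_const,
          Finset.card_univ, smul_eq_mul, Finset.mul_sum, ← Finset.Ico_add_one_right_eq_Icc,
          Finset.sum_Ico_eq_sum_range, Nat.add_sub_cancel, Finset.sum_range]
        refine Finset.sum_congr rfl fun j _ => ?_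
        rw [add_comm 1 (j : ℕ)]
        split_ifs <;> simp
/-- The exponents of the monomials of degree `m` in variables indexed by `C`. -/
def DegreeEq (m : ℕ) : Type := {d : C →₀ ℕ | d.degree = m}

instance (m : ℕ) : MulAction C (DegreeEq C m) where
  smul c d := ⟨d.1.mapDomain (c * ·), (Finsupp.degree_mapDomain _ _).trans d.2⟩
  one_smul d := Subtype.ext (by
    change d.1.mapDomain (fun x => 1 * x) = d.1
    simp only [one_mul]
    exact Finsupp.mapDomain_id)
  mul_smul a b d := Subtype.ext (by
    change d.1.mapDomain (fun x => a * b * x) = (d.1.mapDomain (b * ·)).mapDomain (a * ·)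
    rw [← Finsupp.mapDomain_comp]
    simp only [Function.comp_def, mul_assoc])

theorem DegreeEq.coe_smul {m : ℕ} (c : C) (d : DegreeEq C m) :
    (c • d).1 = d.1.mapDomain (c * ·) := rfl

theorem DegreeEq.smul_eq_self_iff {m : ℕ} (c : C) (d : DegreeEq C m) :
    c • d = d ↔ ∀ y, d.1 (c * y) = d.1 y := by
  have hinj : Function.Injective (c * · : C → C) := mul_right_injective c
  refine Subtype.ext_iff.trans ⟨fun h y => ?_, fun h => ?_⟩
  · conv_lhs => rw [← h]
    exact Finsupp.mapDomain_apply hinj _ _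
  · ext y
    obtain ⟨z, rfl⟩ : ∃ z, c * z = y := ⟨c⁻¹ * y, by simp⟩
    rw [h z]
    exact Finsupp.mapDomain_apply hinj _ _

/-- Exponents of degree `m` as functions on `C` with sum `m`. -/
def DegreeEq.equivPiAntidiag [Fintype C] [DecidableEq C] (m : ℕ) :
    DegreeEq C m ≃ (Finset.univ.piAntidiag m : Finset (C → ℕ)) :=
  Finsupp.equivFunOnFinite.subtypeEquiv fun d => by
    simp only [Finset.mem_piAntidiag, Finset.mem_univ, implies_true, and_true,
      Set.mem_ofPred_eq, Finsupp.degree_eq_sum]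
    rfl

instance [Finite C] (m : ℕ) : Finite (DegreeEq C m) := by
  classical
  have := Fintype.ofFinite C
  exact Finite.of_equiv _ (DegreeEq.equivPiAntidiag C m).symm

theorem DegreeEq.card_fixedBy [Fintype C] [DecidableEq C] (m : ℕ) (c : C) :
    Nat.card (MulAction.fixedBy (DegreeEq C m) c) = (invariantPiAntidiag c m).card := by
  rw [← Nat.card_eq_finsetCard]
  refine Nat.card_congr ((Equiv.subtypeEquiv (equivPiAntidiag C m)
    (q := fun f => ∀ y, f.1 (c * y) = f.1 y) fun d => ?_).trans
      ((Equiv.subtypeSubtypeEquivSubtypeInter _ fun f : C → ℕ => ∀ y, f (c * y) = f y).trans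
        (Equiv.subtypeEquivRight fun f => ?_)))
  · exact smul_eq_self_iff C c d
  · rw [invariantPiAntidiag, Finset.mem_filter]

/-- The basis of monomials of the space of homogeneous polynomials. -/
def symPowBasis (m : ℕ) : Module.Basis (DegreeEq C m) K (SymPow K C m) :=
  .ofRepr <|
    (LinearEquiv.ofEq _ _ (MvPolynomial.homogeneousSubmodule_eq_finsupp_supported C K m)).trans
      (AddMonoidAlgebra.supportedEquivFinsupp (R := K) {d : C →₀ ℕ | d.degree = m})

set_option linter.unusedSectionVars false in
theorem coe_symPowBasis (m : ℕ) (d : DegreeEq C m) :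
    (symPowBasis K C m d : MvPolynomial C K) = MvPolynomial.monomial d.1 1 := by
  have h : symPowBasis K C m d =
      ⟨MvPolynomial.monomial d.1 1, MvPolynomial.isHomogeneous_monomial _ d.2⟩ := by
    rw [Module.Basis.apply_eq_iff]
    ext e
    change (MvPolynomial.monomial d.1 (1 : K)).coeff e.1 = _
    classical
    rw [MvPolynomial.coeff_monomial, Finsupp.single_apply]
    exact if_congr Subtype.ext_iff.symm rfl rfl
  rw [h]

theorem SymAct_symPowBasis (g : C) (m : ℕ) (d : DegreeEq C m) :
    SymAct K C g m (symPowBasis K C m d) = symPowBasis K C m (g • d) := by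
  refine Subtype.ext ?_
  rw [coe_symPowBasis, DegreeEq.coe_smul, ← MvPolynomial.rename_monomial, ← coe_symPowBasis]
  rfl

variable {K C} in
/-- `K[C]/((g-1)^s)` is the group algebra of `C/⟨g^s⟩` when `(g-1)^s = g^s - 1`. -/
def vmodAlgEquiv {g : C} {s : ℕ}
    (h : (MonoidAlgebra.of K C g - 1) ^ s = MonoidAlgebra.of K C (g ^ s) - 1) :
    Vmod K C g s ≃ₐ[K] MonoidAlgebra K (C ⧸ Subgroup.zpowers (g ^ s)) :=
  AlgEquiv.ofAlgHom
    (Ideal.Quotient.liftₐ _ (MonoidAlgebra.mapDomainAlgHom K K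
        (QuotientGroup.mk' (Subgroup.zpowers (g ^ s)))) (by
      intro a ha
      rw [← RingHom.mem_ker]
      refine (Ideal.span_singleton_le_iff_mem _).2 ?_ ha
      rw [h, RingHom.mem_ker, map_sub, map_one, sub_eq_zero]
      simp only [MonoidAlgebra.of_apply, MonoidAlgebra.mapDomainAlgHom_apply,
        MonoidAlgebra.mapDomain_single, QuotientGroup.mk'_apply,
        (QuotientGroup.eq_one_iff _).2 (Subgroup.mem_zpowers (g ^ s))]
      rfl))
    (MonoidAlgebra.lift K _ _ (QuotientGroup.lift _
      ((Ideal.Quotient.mk _ : _ →+* Vmod K C g s).toMonoidHom.comp (MonoidAlgebra.of K C)) (by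
      rw [Subgroup.zpowers_le, MonoidHom.mem_ker]
      change Ideal.Quotient.mk _ (MonoidAlgebra.of K C (g ^ s)) = Ideal.Quotient.mk _ 1
      rw [Ideal.Quotient.eq, ← h]
      exact Ideal.mem_span_singleton_self _)))
    (by
      refine MonoidAlgebra.algHom_ext' (MonoidHom.ext fun x => ?_) (Subsingleton.elim _ _)
      obtain ⟨x, rfl⟩ := QuotientGroup.mk_surjective x
      simp only [MonoidHom.comp_apply, MonoidHom.coe_coe, AlgHom.comp_apply, MonoidAlgebra.of_apply,
        MonoidAlgebra.lift_single, one_smul, QuotientGroup.lift_mk]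
      exact MonoidAlgebra.mapDomain_single)
    (by
      refine Ideal.Quotient.algHom_ext _ (MonoidAlgebra.algHom_ext' (MonoidHom.ext fun x => ?_)
        (Subsingleton.elim _ _))
      change MonoidAlgebra.lift K _ _ _ (MonoidAlgebra.mapDomain _ (MonoidAlgebra.single x 1)) = _
      rw [MonoidAlgebra.mapDomain_single, MonoidAlgebra.lift_single, one_smul]
      rfl)

/-- The image of a group element `x` is the basis vector of `V_s` at the class of `x`. -/
def vmodBasis {g : C} {s : ℕ}
    (h : (MonoidAlgebra.of K C g - 1) ^ s = MonoidAlgebra.of K C (g ^ s) - 1) :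
    Module.Basis (C ⧸ Subgroup.zpowers (g ^ s)) K (Vmod K C g s) :=
  (MonoidAlgebra.basis _ K).map (vmodAlgEquiv h).symm.toLinearEquiv

theorem vmodBasis_mk {g : C} {s : ℕ}
    (h : (MonoidAlgebra.of K C g - 1) ^ s = MonoidAlgebra.of K C (g ^ s) - 1) (x : C) :
    vmodBasis K C h (QuotientGroup.mk x) = Ideal.Quotient.mk _ (MonoidAlgebra.of K C x) := by
  rw [vmodBasis, Module.Basis.map_apply]
  change (vmodAlgEquiv h).symm _ = _
  rw [AlgEquiv.symm_apply_eq]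
  exact (MonoidAlgebra.mapDomain_single (f := QuotientGroup.mk' _)).symm

theorem VmodAct_vmodBasis {g : C} {s : ℕ}
    (h : (MonoidAlgebra.of K C g - 1) ^ s = MonoidAlgebra.of K C (g ^ s) - 1)
    (x : C ⧸ Subgroup.zpowers (g ^ s)) :
    VmodAct K C g s (vmodBasis K C h x) = vmodBasis K C h (g • x) := by
  obtain ⟨x, rfl⟩ := QuotientGroup.mk_surjective x
  rw [MulAction.Quotient.smul_mk, smul_eq_mul, vmodBasis_mk, vmodBasis_mk, map_mul, map_mul]
  rfl

theorem Sigma.card_fixedBy {G ι : Type*} {X : ι → Type*} [Group G] [∀ i, MulAction G (X i)]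
    [Fintype ι] [∀ i, Finite (X i)] (c : G) :
    Nat.card (MulAction.fixedBy (Σ i, X i) c) =
      ∑ i, Nat.card (MulAction.fixedBy (X i) c) := by
  rw [← Nat.card_sigma]
  refine Nat.card_congr
    { toFun := fun x => ⟨x.1.1, x.1.2, eq_of_heq (Sigma.mk.inj_iff.1 x.2).2⟩
      invFun := fun x => ⟨⟨x.1, x.2.1⟩, Sigma.ext rfl (heq_of_eq x.2.2)⟩
      left_inv := fun _ => rfl
      right_inv := fun _ => rfl }

theorem Prod.card_fixedBy {G X Y : Type*} [Group G] [MulAction G X] [MulAction G Y] (c : G) :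
    Nat.card (MulAction.fixedBy (X × Y) c) =
      Nat.card (MulAction.fixedBy X c) * Nat.card (MulAction.fixedBy Y c) := by
  rw [← Nat.card_prod]
  refine Nat.card_congr
    { toFun := fun x => (⟨x.1.1, congrArg Prod.fst x.2⟩, ⟨x.1.2, congrArg Prod.snd x.2⟩)
      invFun := fun x => ⟨(x.1.1, x.2.1), Prod.ext x.1.2 x.2.2⟩
      left_inv := fun _ => rfl
      right_inv := fun _ => rfl }

theorem QuotientGroup.card_fixedBy {G : Type*} [CommGroup G] (H : Subgroup G)
    (c : G) [Decidable (c ∈ H)] :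
    Nat.card (MulAction.fixedBy (G ⧸ H) c) = if c ∈ H then Nat.card (G ⧸ H) else 0 := by
  have h : ∀ x : G ⧸ H, c • x = x ↔ c ∈ H := by
    intro x
    obtain ⟨x, rfl⟩ := QuotientGroup.mk_surjective x
    rw [MulAction.Quotient.smul_mk, smul_eq_mul, eq_comm, QuotientGroup.eq, mul_comm c,
      inv_mul_cancel_left]
  split_ifs with hc
  · exact Nat.card_congr (Equiv.subtypeUnivEquiv fun x => (h x).2 hc)
  · rw [Nat.card_eq_zero]
    exact .inl ⟨fun x => hc ((h _).1 x.2)⟩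

theorem card_zpowers_generator_pow {G : Type*} [Group G] [Finite G] {g : G}
    (hg : ∀ x : G, x ∈ Subgroup.zpowers g) {d : ℕ} (hd : d ∣ Nat.card G) :
    Nat.card (Subgroup.zpowers (g ^ (Nat.card G / d))) = d := by
  have hpos : 0 < Nat.card G := Nat.card_pos
  rw [Nat.card_zpowers, orderOf_pow, orderOf_eq_card_of_forall_mem_zpowers hg,
    Nat.gcd_eq_right (Nat.div_dvd_of_dvd hd), Nat.div_div_self hd hpos.ne']

theorem mem_zpowers_generator_pow_iff {G : Type*} [Group G] [Finite G] {g : G}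
    (hg : ∀ x : G, x ∈ Subgroup.zpowers g) (j : ℕ) (c : G) :
    c ∈ Subgroup.zpowers (g ^ (Nat.card G / j.gcd (Nat.card G))) ↔ orderOf c ∣ j := by
  have hd := Nat.gcd_dvd_right j (Nat.card G)
  have hdpos : 0 < j.gcd (Nat.card G) := Nat.gcd_pos_of_pos_right _ Nat.card_pos
  constructor
  · intro hc
    have := Subgroup.orderOf_dvd_natCard _ hc
    rw [card_zpowers_generator_pow hg hd] at this
    exact this.trans (Nat.gcd_dvd_left _ _)
  · intro hc
    have hcd : orderOf c ∣ j.gcd (Nat.card G) := Nat.dvd_gcd hc (orderOf_dvd_natCard c)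
    obtain ⟨r, rfl⟩ := mem_powers_iff_mem_zpowers.2 (hg c)
    simp only at hcd ⊢
    rw [orderOf_dvd_iff_pow_eq_one, ← pow_mul, ← orderOf_dvd_iff_pow_eq_one,
      orderOf_eq_card_of_forall_mem_zpowers hg] at hcd
    obtain ⟨t, ht⟩ := (Nat.div_dvd_iff_dvd_mul hd hdpos).2 (mul_comm r _ ▸ hcd)
    exact ht ▸ pow_mul g _ t ▸ Subgroup.npow_mem_zpowers _ t

/-- A product of linear maps permuting bases permutes the product basis. -/
theorem pi_comp_proj_basis {R ι G : Type*} [Semiring R] [Fintype ι] {M X : ι → Type*}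
    [∀ i, AddCommMonoid (M i)] [∀ i, Module R (M i)] [∀ i, SMul G (X i)] (g : G)
    (A : ∀ i, M i →ₗ[R] M i) (b : ∀ i, Module.Basis (X i) R (M i))
    (h : ∀ i x, A i (b i x) = b i (g • x)) (x : Σ i, X i) :
    LinearMap.pi (fun i => (A i).comp (LinearMap.proj i)) (Pi.basis b x) = Pi.basis b (g • x) := by
  classical
  obtain ⟨i, x⟩ := x
  rw [Sigma.smul_mk, Pi.basis_apply, Pi.basis_apply, ← h]
  ext k
  exact (Pi.apply_single (fun i => A i) (fun i => map_zero _) _ _ _).trans (by rfl)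

/-- The basis of the `j`-th term given by the bases of its tensor factors. -/
def symTermBasis (g : C) (q n j : ℕ)
    (h : (MonoidAlgebra.of K C g - 1) ^ (q / j.gcd q) =
      MonoidAlgebra.of K C (g ^ (q / j.gcd q)) - 1) :
    Module.Basis ((Σ _ : Fin (j.gcd q), C ⧸ Subgroup.zpowers (g ^ (q / j.gcd q))) ×
      DegreeEq C (n - j)) K (SymTerm K C g q n j) :=
  (Pi.basis fun _ => vmodBasis K C h).tensorProduct (symPowBasis K C (n - j))

theorem SymTermAct_symTermBasis (g : C) (q n j : ℕ)
    (h : (MonoidAlgebra.of K C g - 1) ^ (q / j.gcd q) =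
      MonoidAlgebra.of K C (g ^ (q / j.gcd q)) - 1)
    (x) :
    SymTermAct K C g q n j (symTermBasis K C g q n j h x) = symTermBasis K C g q n j h (g • x) := by
  obtain ⟨x, d⟩ := x
  rw [Prod.smul_mk, symTermBasis, Module.Basis.tensorProduct_apply,
    Module.Basis.tensorProduct_apply, SymTermAct, TensorProduct.map_tmul, SymAct_symPowBasis,
    ← pi_comp_proj_basis g _ (fun _ => vmodBasis K C h) fun _ => VmodAct_vmodBasis K C h]
  rfl

theorem sub_one_pow_div_gcd {p : ℕ} [Fact p.Prime] [CharP K p] (g : C) (k j : ℕ) :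
    (MonoidAlgebra.of K C g - 1) ^ (p ^ k / j.gcd (p ^ k)) =
      MonoidAlgebra.of K C (g ^ (p ^ k / j.gcd (p ^ k))) - 1 := by
  have : CharP (MonoidAlgebra K C) p :=
    charP_of_injective_algebraMap (FaithfulSMul.algebraMap_injective K (MonoidAlgebra K C)) p
  have hp : p.Prime := Fact.out
  obtain ⟨i, hi, h⟩ := (Nat.dvd_prime_pow hp).1 (Nat.gcd_dvd_right j (p ^ k))
  rw [h, Nat.pow_div hi hp.pos, sub_pow_char_pow, one_pow, map_pow]

/-- **Module-level form of `ψ_S^n(K[C]) = gcd(n,q)·V_{q/gcd(n,q)}` (Proposition 4.6 of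
Bryant–Johnson).**  Let `K` be a field of prime characteristic `p` and `C` a cyclic
group of order `q = p^k` (`k ≥ 1`) with generator `g`.  Then for every `n ≥ 1` there is
an isomorphism of `K[C]`-modules
`(S^n K[C])^{⊕n} ≅ ⊕_{j=1}^{n} (V_{q/gcd(j,q)})^{⊕ gcd(j,q)} ⊗ S^{n−j}(K[C])`,
expressed as a `K`-linear equivalence intertwining the actions of `g`. -/
theorem symmetricPower_newton_isomorphism
    (p : ℕ) [Fact p.Prime] [CharP K p] [Fintype C]
    (k : ℕ) (hk : 1 ≤ k) (q : ℕ) (hq : q = p ^ k) (hcard : Fintype.card C = q)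
    (g : C) (hg : ∀ x : C, x ∈ Subgroup.zpowers g)
    (n : ℕ) (hn : 1 ≤ n) :
    ∃ e : (Fin n → SymPow K C n) ≃ₗ[K] (∀ j : Fin n, SymTerm K C g q n ((j : ℕ) + 1)),
      ∀ x, e (LinearMap.compLeft (SymAct K C g n) (Fin n) x)
        = LinearMap.pi
            (fun j : Fin n => (SymTermAct K C g q n ((j : ℕ) + 1)).comp (LinearMap.proj j))
            (e x) := by
  subst hq
  classical
  have hcard' : Nat.card C = p ^ k := by rw [Nat.card_eq_fintype_card, hcard]
  have hV := fun j => sub_one_pow_div_gcd K C (p := p) g k j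
  let b : Module.Basis (Σ _ : Fin n, DegreeEq C n) K (Fin n → SymPow K C n) :=
    Pi.basis fun _ => symPowBasis K C n
  let b' := Pi.basis fun j : Fin n => symTermBasis K C g (p ^ k) n ((j : ℕ) + 1) (hV _)
  obtain ⟨φ, hφ⟩ : ∃ φ : (Σ _ : Fin n, DegreeEq C n) ≃
      (Σ j : Fin n, (Σ _ : Fin (Nat.gcd ((j : ℕ) + 1) (p ^ k)),
        C ⧸ Subgroup.zpowers (g ^ (p ^ k / Nat.gcd ((j : ℕ) + 1) (p ^ k)))) ×
          DegreeEq C (n - ((j : ℕ) + 1))), ∀ x, φ (g • x) = g • φ x := by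
    refine MulAction.exists_equiv_of_card_fixedBy g fun c => ?_
    rw [Sigma.card_fixedBy, Sigma.card_fixedBy]
    simp only [Prod.card_fixedBy, Sigma.card_fixedBy, DegreeEq.card_fixedBy,
      QuotientGroup.card_fixedBy, Finset.sum_const, Finset.card_univ, Fintype.card_fin,
      smul_eq_mul]
    rw [mul_card_invariantPiAntidiag]
    refine Finset.sum_congr rfl fun j _ => ?_
    have hd := Nat.gcd_dvd_right ((j : ℕ) + 1) (Nat.card C)
    have hH := Subgroup.card_eq_card_quotient_mul_card_subgroup
      (Subgroup.zpowers (g ^ (Nat.card C / Nat.gcd ((j : ℕ) + 1) (Nat.card C))))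
    rw [card_zpowers_generator_pow hg hd] at hH
    rw [← hcard', ← Nat.card_eq_fintype_card]
    simp only [mem_zpowers_generator_pow_iff hg]
    split_ifs
    · rw [mul_comm (Nat.gcd _ _), ← hH]
    · simp
  refine ⟨b.equiv b' φ, fun x => ?_⟩
  refine LinearMap.congr_fun (f := (b.equiv b' φ).toLinearMap ∘ₗ
      LinearMap.compLeft (SymAct K C g n) (Fin n))
    (g := LinearMap.pi (fun j : Fin n =>
      (SymTermAct K C g (p ^ k) n ((j : ℕ) + 1)).comp (LinearMap.proj j)) ∘ₗ
        (b.equiv b' φ).toLinearMap) (b.ext fun i => ?_) x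
  have hb : LinearMap.compLeft (SymAct K C g n) (Fin n) (b i) = b (g • i) :=
    pi_comp_proj_basis g _ _ (fun _ => SymAct_symPowBasis K C g n) i
  rw [LinearMap.comp_apply, LinearMap.comp_apply, hb, LinearEquiv.coe_coe,
    Module.Basis.equiv_apply, Module.Basis.equiv_apply, hφ]
  exact (pi_comp_proj_basis g _ _ (fun j => SymTermAct_symTermBasis K C g (p ^ k) n _ (hV _)) _).symm

end
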